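/- Assume condition (C1). Then the matching-form TIN-achievable polytope is monotonically non-decreasing in the user subset: for all S1 ⊆ S2 ⊆ K, P^TINA_{S1} ⊆ P^TINA_{S2}. -/

import Mathlib

noncomputable def alphaP {ι : Type*} [DecidableEq ι] (α : ι → ι → ℝ) (i j : ι) : ℝ :=
  if i = j then 0 else α i j

/-- A matching of the complete bipartite graph on `S × S`: a set of pairs in which no two
pairs share the same first coordinate and no two pairs share the same second coordinate. -/
def IsMatching {ι : Type*} (S : Finset ι) (M : Finset (ι × ι)) : Prop :=
  M ⊆ S ×ˢ S ∧
  (∀ p ∈ M, ∀ q ∈ M, p.1 = q.1 → p = q) ∧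
  (∀ p ∈ M, ∀ q ∈ M, p.2 = q.2 → p = q)

/-- The maximum weight `w(M*_S)` of a matching of the complete bipartite graph on `S × S`
with weights `α'` (the empty matching is allowed, so `w(M*_S) = 0` when `|S| ≤ 1`
whenever `α'` has zero diagonal and is nonnegative). -/
noncomputable def wStar {ι : Type*} [DecidableEq ι] (α' : ι → ι → ℝ) (S : Finset ι) : ℝ :=
  letI := Classical.propDecidable
  ((S ×ˢ S).powerset.filter (fun M => IsMatching S M)).sup'
    ⟨∅, by simp [IsMatching, Finset.mem_filter]⟩ (fun M => ∑ p ∈ M, α' p.1 p.2)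

/-- The matching-form polyhedral TIN-achievable region `P^TINA_S`. -/
noncomputable def TINA {ι : Type*} [DecidableEq ι] (α : ι → ι → ℝ) (S : Finset ι)
    (d : ι → ℝ) : Prop :=
  (∀ i ∉ S, d i = 0) ∧ (∀ k ∈ S, 0 ≤ d k) ∧
  ∀ S' ⊆ S, S'.Nonempty → ∑ k ∈ S', d k ≤ ∑ k ∈ S', α k k - wStar (alphaP α) S'

/-- Condition (C1): for every `k`, `α_{kk} ≥ α_{ik} + α_{kj} − α'_{ij}` for all `i ≠ k`,
`j ≠ k`. -/
def CondC1 {ι : Type*} [DecidableEq ι] (α : ι → ι → ℝ) : Prop :=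
  ∀ k i j : ι, i ≠ k → j ≠ k → α i k + α k j - alphaP α i j ≤ α k k

/-- Condition (C2): every subset of size `> 2` admits a maximum-weight matching containing
a zero-strength pair. -/
def CondC2 {ι : Type*} [DecidableEq ι] (α : ι → ι → ℝ) : Prop :=
  ∀ S' : Finset ι, 2 < S'.card →
    ∃ M : Finset (ι × ι), IsMatching S' M ∧
      (∑ p ∈ M, alphaP α p.1 p.2) = wStar (alphaP α) S' ∧
      ∃ p ∈ M, α p.1 p.2 = 0

theorem IsMatching.sum_le_wStar {ι : Type*} [DecidableEq ι] (w : ι → ι → ℝ) {S : Finset ι}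
    {M : Finset (ι × ι)} (hM : IsMatching S M) : ∑ p ∈ M, w p.1 p.2 ≤ wStar w S := by
  classical
  unfold wStar
  exact Finset.le_sup' (fun M : Finset (ι × ι) => ∑ p ∈ M, w p.1 p.2)
    (by simpa using ⟨hM.1, hM⟩)

theorem wStar_le {ι : Type*} [DecidableEq ι] (w : ι → ι → ℝ) {S : Finset ι} {c : ℝ}
    (h : ∀ M, IsMatching S M → ∑ p ∈ M, w p.1 p.2 ≤ c) : wStar w S ≤ c := by
  classical
  unfold wStar
  exact Finset.sup'_le _ _ fun M hM => h M (by simp at hM; exact hM.2)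

theorem wStar_empty {ι : Type*} [DecidableEq ι] (w : ι → ι → ℝ) : wStar w ∅ = 0 := by
  refine le_antisymm (wStar_le w fun M hM => ?_) ?_
  · have : M = ∅ := by simpa using hM.1
    simp [this]
  · have h : IsMatching (∅ : Finset ι) ∅ := by simp [IsMatching]
    simpa using h.sum_le_wStar w

/-- The pairs of a matching that avoid `k` form a matching of the set without `k`. -/
theorem IsMatching.filter_ne {ι : Type*} [DecidableEq ι] {k : ι} {T : Finset ι}
    {M : Finset (ι × ι)} (hM : IsMatching (insert k T) M) :
    IsMatching T {p ∈ M | p.2 ≠ k ∧ p.1 ≠ k} := by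
  obtain ⟨hsub, h1, h2⟩ := hM
  refine ⟨fun p hp => ?_, fun p hp q hq => ?_, fun p hp q hq => ?_⟩
  · obtain ⟨hp, hk2, hk1⟩ := Finset.mem_filter.1 hp
    have := hsub hp
    simp_all [Finset.mem_product]
  · exact h1 p (Finset.mem_filter.1 hp).1 q (Finset.mem_filter.1 hq).1
  · exact h2 p (Finset.mem_filter.1 hp).1 q (Finset.mem_filter.1 hq).1

/-- Bypassing `k`: the pairs `(i, k)` and `(k, j)` are replaced by `(i, j)`. -/
theorem IsMatching.insert_filter_ne {ι : Type*} [DecidableEq ι] {i j k : ι} {T : Finset ι}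
    {M : Finset (ι × ι)} (hM : IsMatching (insert k T) M) (hik : (i, k) ∈ M) (hkj : (k, j) ∈ M)
    (hi : i ≠ k) (hj : j ≠ k) :
    (i, j) ∉ ({p ∈ M | p.2 ≠ k ∧ p.1 ≠ k} : Finset (ι × ι)) ∧
      IsMatching T (insert (i, j) {p ∈ M | p.2 ≠ k ∧ p.1 ≠ k}) := by
  obtain ⟨hsub, h1, h2⟩ := hM.filter_ne
  have hfst : ∀ q ∈ ({p ∈ M | p.2 ≠ k ∧ p.1 ≠ k} : Finset (ι × ι)), i ≠ q.1 := by
    intro q hq h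
    obtain ⟨hq, hq2, -⟩ := Finset.mem_filter.1 hq
    exact hq2 (by rw [← hM.2.1 _ hik q hq h])
  have hsnd : ∀ q ∈ ({p ∈ M | p.2 ≠ k ∧ p.1 ≠ k} : Finset (ι × ι)), j ≠ q.2 := by
    intro q hq h
    obtain ⟨hq, -, hq1⟩ := Finset.mem_filter.1 hq
    exact hq1 (by rw [← hM.2.2 _ hkj q hq h])
  have hiT : i ∈ T := by
    exact Finset.mem_of_mem_insert_of_ne (Finset.mem_product.1 (hM.1 hik)).1 hi
  have hjT : j ∈ T := by
    exact Finset.mem_of_mem_insert_of_ne (Finset.mem_product.1 (hM.1 hkj)).2 hj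
  refine ⟨fun h => hfst _ h rfl, ?_, ?_, ?_⟩
  · exact Finset.insert_subset (Finset.mem_product.2 ⟨hiT, hjT⟩) hsub
  · intro p hp q hq h
    rcases Finset.mem_insert.1 hp with rfl | hp <;> rcases Finset.mem_insert.1 hq with rfl | hq
    · rfl
    · exact absurd h (hfst q hq)
    · exact absurd h.symm (hfst p hp)
    · exact h1 p hp q hq h
  · intro p hp q hq h
    rcases Finset.mem_insert.1 hp with rfl | hp <;> rcases Finset.mem_insert.1 hq with rfl | hq
    · rfl
    · exact absurd h (hsnd q hq)
    · exact absurd h.symm (hsnd p hp)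
    · exact h2 p hp q hq h

theorem CondC1.add_le {ι : Type*} [DecidableEq ι] {α : ι → ι → ℝ} (hC1 : CondC1 α) {i k : ι}
    (hi : i ≠ k) : α i k + α k i ≤ α k k := by
  simpa [alphaP] using hC1 k i i hi hi

theorem wStar_insert_le {ι : Type*} [DecidableEq ι] {α : ι → ι → ℝ}
    (hα : ∀ i j, 0 ≤ α i j) (hC1 : CondC1 α) (k : ι) (T : Finset ι) :
    wStar (alphaP α) (insert k T) ≤ wStar (alphaP α) T + α k k := by
  refine wStar_le _ fun M hM => ?_
  have hsplit : ∑ p ∈ M, alphaP α p.1 p.2 =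
      ∑ p ∈ M with p.2 = k, alphaP α p.1 p.2 +
        (∑ p ∈ M with p.2 ≠ k ∧ p.1 = k, alphaP α p.1 p.2 +
          ∑ p ∈ M with p.2 ≠ k ∧ p.1 ≠ k, alphaP α p.1 p.2) := by
    rw [← Finset.sum_filter_add_sum_filter_not M (fun p => p.2 = k),
      ← Finset.sum_filter_add_sum_filter_not (M.filter fun p => ¬p.2 = k) (fun p => p.1 = k),
      Finset.filter_filter, Finset.filter_filter]
  have hrest := hM.filter_ne.sum_le_wStar (alphaP α)
  have hk := hα k k
  have hcol : (∑ p ∈ M with p.2 = k, alphaP α p.1 p.2 = 0) ∨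
      ∃ i, i ≠ k ∧ (i, k) ∈ M ∧ ∑ p ∈ M with p.2 = k, alphaP α p.1 p.2 = α i k := by
    by_cases h : ∃ i, i ≠ k ∧ (i, k) ∈ M
    · obtain ⟨i, hi, hik⟩ := h
      have : M.filter (fun p => p.2 = k) = {(i, k)} := by
        ext p
        simp only [Finset.mem_filter, Finset.mem_singleton]
        refine ⟨fun hp => hM.2.2 p hp.1 _ hik hp.2, ?_⟩
        rintro rfl
        exact ⟨hik, rfl⟩
      exact .inr ⟨i, hi, hik, by simp [this, alphaP, hi]⟩
    · refine .inl (Finset.sum_eq_zero fun p hp => ?_)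
      obtain ⟨hpM, rfl⟩ := Finset.mem_filter.1 hp
      by_cases hpk : p.1 = p.2
      · simp [alphaP, hpk]
      · exact absurd ⟨p.1, hpk, hpM⟩ h
  have hrow : (∑ p ∈ M with p.2 ≠ k ∧ p.1 = k, alphaP α p.1 p.2 = 0) ∨
      ∃ j, j ≠ k ∧ (k, j) ∈ M ∧
        ∑ p ∈ M with p.2 ≠ k ∧ p.1 = k, alphaP α p.1 p.2 = α k j := by
    by_cases h : ∃ j, j ≠ k ∧ (k, j) ∈ M
    · obtain ⟨j, hj, hkj⟩ := h
      have : M.filter (fun p => p.2 ≠ k ∧ p.1 = k) = {(k, j)} := by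
        ext p
        simp only [Finset.mem_filter, Finset.mem_singleton]
        refine ⟨fun hp => hM.2.1 p hp.1 _ hkj hp.2.2, ?_⟩
        rintro rfl
        exact ⟨hkj, hj, rfl⟩
      exact .inr ⟨j, hj, hkj, by simp [this, alphaP, hj.symm]⟩
    · refine .inl (Finset.sum_eq_zero fun p hp => ?_)
      obtain ⟨hpM, hp2, rfl⟩ := Finset.mem_filter.1 hp
      exact absurd ⟨p.2, hp2, hpM⟩ h
  rw [hsplit]
  rcases hcol with hcol | ⟨i, hi, hik, hcol⟩ <;> rcases hrow with hrow | ⟨j, hj, hkj, hrow⟩ <;>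
    rw [hcol, hrow]
  · linarith
  · linarith [hC1.add_le hj, hα j k]
  · linarith [hC1.add_le hi, hα k i]
  · obtain ⟨hnot, hbyp⟩ := hM.insert_filter_ne hik hkj hi hj
    have := hbyp.sum_le_wStar (alphaP α)
    rw [Finset.sum_insert hnot] at this
    linarith [hC1 k i j hi hj]

theorem wStar_union_le {ι : Type*} [DecidableEq ι] {α : ι → ι → ℝ}
    (hα : ∀ i j, 0 ≤ α i j) (hC1 : CondC1 α) (U T : Finset ι) :
    wStar (alphaP α) (U ∪ T) ≤ wStar (alphaP α) T + ∑ k ∈ U, α k k := by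
  induction U using Finset.induction_on with
  | empty => simp
  | insert k U hk ih =>
    rw [Finset.insert_union, Finset.sum_insert hk]
    linarith [wStar_insert_le hα hC1 k (U ∪ T)]

/-- Under condition (C1), the matching-form TIN-achievable polytope is
monotonically non-decreasing in the user subset: `S1 ⊆ S2` implies
`P^TINA_{S1} ⊆ P^TINA_{S2}`. -/
theorem tina_monotone_of_C1 {ι : Type*} [Fintype ι] [DecidableEq ι]
    (α : ι → ι → ℝ) (hα : ∀ i j, 0 ≤ α i j) (hC1 : CondC1 α) :
    ∀ S1 S2 : Finset ι, S1 ⊆ S2 → ∀ d : ι → ℝ, TINA α S1 d → TINA α S2 d := by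
  intro S1 S2 hS d hd
  obtain ⟨hzero, hnonneg, hsum⟩ := hd
  refine ⟨fun i hi => hzero i fun h => hi (hS h), fun k _ => ?_, fun S' _ _ => ?_⟩
  · by_cases hk : k ∈ S1
    · exact hnonneg k hk
    · exact (hzero k hk).ge
  have hd : ∑ k ∈ S', d k = ∑ k ∈ S' ∩ S1, d k :=
    (Finset.sum_subset Finset.inter_subset_left fun k hk hk' =>
      hzero k fun h => hk' (Finset.mem_inter.2 ⟨hk, h⟩)).symm
  have hT : ∑ k ∈ S' ∩ S1, d k ≤ ∑ k ∈ S' ∩ S1, α k k - wStar (alphaP α) (S' ∩ S1) := by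
    rcases (S' ∩ S1).eq_empty_or_nonempty with h | h
    · simp [h, wStar_empty]
    · exact hsum _ Finset.inter_subset_right h
  have hw := wStar_union_le hα hC1 (S' \ (S' ∩ S1)) (S' ∩ S1)
  rw [Finset.sdiff_union_of_subset Finset.inter_subset_left] at hw
  have hα' := Finset.sum_sdiff (f := fun k => α k k) (Finset.inter_subset_left (s₁ := S') (s₂ := S1))
  linarith
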